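/- arXiv:2102.03760 — 2 statements merged into one kernel-verified Lean document; each statement's English description precedes it below -/
import Mathlib

section
/- Let N be the N-matrix of a mixed graph whose underlying graph G is connected and contains a triangle (three mutually adjacent vertices). Then every eigenvalue λ of N satisfies |λ| < 2 if and only if the mixed graph has exactly 3 vertices and the weight of its triangle, N_{v₁v₂}·N_{v₂v₃}·N_{v₃v₁}, lies in {ω, ω̄, −ω, −ω̄} (the triangle is semi-positive or semi-negative). -/
open Matrix Complex

/-- The sixth root of unity `ω = (1 + i√3)/2`. -/
noncomputable def ω6 : ℂ := (1 + Complex.I * Real.sqrt 3) / 2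

lemma sixth_factor {z : ℂ} (h : z ^ 6 = 1) : z = 1 ∨ z = -1 ∨ z ^ 2 - z + 1 = 0 ∨ z ^ 2 + z + 1 = 0 := by
  have : (z - 1) * ((z + 1) * ((z ^ 2 - z + 1) * (z ^ 2 + z + 1))) = 0 := by
    linear_combination h
  rcases mul_eq_zero.1 this with h | h
  · left; linear_combination h
  rcases mul_eq_zero.1 h with h | h
  · right; left; linear_combination h
  rcases mul_eq_zero.1 h with h | h <;> tauto

lemma s3 : ((Real.sqrt 3 : ℝ) : ℂ) ^ 2 = 3 := by
  norm_cast
  simp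

lemma star_ω6 : star ω6 = (1 - Complex.I * Real.sqrt 3) / 2 := by
  simp [ω6, sub_eq_add_neg]

lemma ω6_sq : ω6 ^ 2 = ω6 - 1 := by
  rw [ω6]
  linear_combination (1/4 : ℂ) * I ^ 2 * s3 + (3/4 : ℂ) * I_sq

lemma sω6_sq : (star ω6) ^ 2 = star ω6 - 1 := by
  have := congrArg star ω6_sq
  simpa using this

lemma ω6_add : ω6 + star ω6 = 1 := by
  rw [star_ω6, ω6]; ring

lemma ω6_mul : ω6 * star ω6 = 1 := by
  linear_combination ω6 * ω6_add - ω6_sq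

lemma ent_mul {z : ℂ} (h : z ∈ ({0, 1, ω6, star ω6} : Set ℂ)) (h0 : z ≠ 0) : z * star z = 1 := by
  rcases h with h | h | h | h
  · exact absurd h h0
  · simp [h]
  · rw [h]; exact ω6_mul
  · rw [h, star_star, mul_comm]; exact ω6_mul

lemma pow6_of {z : ℂ} (h : z ^ 2 = z - 1) : z ^ 6 = 1 := by
  linear_combination (z^4 + z^3 - z - 1) * h

lemma ent_pow {z : ℂ} (h : z ∈ ({0, 1, ω6, star ω6} : Set ℂ)) (h0 : z ≠ 0) : z ^ 6 = 1 := by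
  rcases h with h | h | h | h
  · exact absurd h h0
  · rw [h]; simp
  · rw [h]; exact pow6_of ω6_sq
  · rw [h]; exact pow6_of sω6_sq

lemma mem_of_quad {z : ℂ} (h : z ^ 2 - z + 1 = 0) : z = ω6 ∨ z = star ω6 := by
  have : (z - ω6) * (z - star ω6) = 0 := by
    linear_combination h - z * ω6_add + ω6_mul
  rcases mul_eq_zero.1 this with h | h
  · left; linear_combination h
  · right; linear_combination h

lemma sixth_cases {z : ℂ} (h : z ^ 6 = 1) :
    z = 1 ∨ z = -1 ∨ z ∈ ({ω6, star ω6, -ω6, -star ω6} : Set ℂ) := by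
  rcases sixth_factor h with h | h | h | h
  · simp [h]
  · simp [h]
  · rcases mem_of_quad h with h | h <;> simp [h]
  · rcases mem_of_quad (z := -z) (by linear_combination h) with h | h
    · right; right; rw [← neg_neg z, h]; simp
    · right; right; rw [← neg_neg z, h]; simp

lemma ω6_re : ω6.re = 1/2 := by
  have := congrArg re ω6_add
  simp at this; linarith

lemma semi_re {z : ℂ} (h : z ∈ ({ω6, star ω6, -ω6, -star ω6} : Set ℂ)) :
    z.re = 1/2 ∨ z.re = -1/2 := by
  rcases h with h | h | h | h <;> rw [h] <;> simp [ω6_re] <;> norm_num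

lemma sixth_re {z : ℂ} (h : z ^ 6 = 1) : z = 1 ∨ z = -1 ∨ z.re = 1/2 ∨ z.re = -1/2 := by
  rcases sixth_cases h with h | h | h
  · tauto
  · tauto
  · have := semi_re h; tauto

lemma sixth_re_ge {z : ℂ} (h : z ^ 6 = 1) : -1 ≤ z.re := by
  rcases sixth_re h with h | h | h | h <;> rw [h] <;> norm_num

lemma sixth_re_ge' {z : ℂ} (h : z ^ 6 = 1) : z = -1 ∨ -1/2 ≤ z.re := by
  rcases sixth_re h with h | h | h | h
  · right; rw [h]; norm_num
  · left; exact h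
  · right; rw [h]; norm_num
  · right; rw [h]

lemma det3 (t a b d a' b' d' : ℂ) :
    det !![t, -a, -b; -a', t, -d; -b', -d', t] =
      t ^ 3 - t * (a * a' + b * b' + d * d') - (a * d * b' + a' * d' * b) := by
  rw [det_fin_three]; simp; ring

lemma det4 (t a b c d e f a' b' c' d' e' f' : ℂ) :
    det !![t, -a, -b, -c; -a', t, -d, -e; -b', -d', t, -f; -c', -e', -f', t] =
      t ^ 4 - t ^ 2 * (a * a' + b * b' + c * c' + d * d' + e * e' + f * f')
      - t * ((a * d * b' + a' * d' * b) + (a * e * c' + a' * e' * c) + (b * f * c' + b' * f' * c)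
        + (d * f * e' + d' * f' * e))
      + (a * a' * (f * f') + b * b' * (e * e') + c * c' * (d * d'))
      - (a * d * f * c' + a' * d' * f' * c) - (a * e * f' * b' + a' * e' * f * b)
      - (b * d' * e * c' + b' * d * e' * c) := by
  rw [det_succ_row_zero]
  simp [Fin.sum_univ_succ, det_fin_three, Fin.succAbove]
  ring

section
variable {V : Type*} [Fintype V] [DecidableEq V]

open ComplexOrder in
lemma posDef_shift (N : Matrix V V ℂ) (hherm : N.IsHermitian)
    (h : ∀ i, |hherm.eigenvalues i| < 2) (s : ℝ) (hs : s = 1 ∨ s = -1) :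
    ((2:ℂ) • (1 : Matrix V V ℂ) - (s:ℂ) • N).PosDef := by
  have hd : (diagonal (fun i => (2 : ℂ) - s * hherm.eigenvalues i)).PosDef := by
    rw [posDef_diagonal_iff]
    intro i
    have := abs_lt.1 (h i)
    have h2 : (0:ℝ) < 2 - s * hherm.eigenvalues i := by
      rcases hs with rfl | rfl <;> linarith
    exact_mod_cast h2
  have hU := hherm.spectral_theorem
  set U := hherm.eigenvectorUnitary
  rw [Unitary.conjStarAlgAut_apply] at hU
  have huu : (U : Matrix V V ℂ) * star (U : Matrix V V ℂ) = 1 := Unitary.coe_mul_star_self U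
  have key : ((2:ℂ) • (1 : Matrix V V ℂ) - (s:ℂ) • N) = (U : Matrix V V ℂ) *
      diagonal (fun i => (2 : ℂ) - s * hherm.eigenvalues i) * star (U : Matrix V V ℂ) := by
    have : diagonal (fun i => (2 : ℂ) - s * hherm.eigenvalues i) =
      (2:ℂ) • (1 : Matrix V V ℂ) - (s:ℂ) • diagonal (RCLike.ofReal ∘ hherm.eigenvalues) := by
      ext i j
      by_cases hij : i = j
      · subst hij; simp
      · simp [hij]
    rw [this, mul_sub, sub_mul]
    conv_lhs => rw [hU]
    simp [huu]
  rw [key]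
  rw [Matrix.IsUnit.posDef_star_right_conjugate_iff]
  · exact hd
  · exact (Unitary.toUnits U).isUnit

open ComplexOrder in
lemma det_sub_pos (N : Matrix V V ℂ) (hherm : N.IsHermitian)
    (h : ∀ i, |hherm.eigenvalues i| < 2) (s : ℝ) (hs : s = 1 ∨ s = -1)
    {n : ℕ} (g : Fin n → V) (hg : Function.Injective g) :
    0 < (det (((2:ℂ) • (1 : Matrix V V ℂ) - (s:ℂ) • N).submatrix g g)).re := by
  have := ((posDef_shift N hherm h s hs).submatrix hg).det_pos
  exact (Complex.lt_def.1 this).1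
end

lemma re_add_star (z : ℂ) : (z + star z).re = 2 * z.re := by
  simp; ring

section
variable {V : Type*} [Fintype V] [DecidableEq V]

lemma det_shift3 (N : Matrix V V ℂ) (hherm : N.IsHermitian) (hdiag : ∀ u, N u u = 0)
    (t s : ℂ) (u v w : V) (huv : u ≠ v) (huw : u ≠ w) (hvw : v ≠ w) :
    det ((t • (1 : Matrix V V ℂ) - s • N).submatrix ![u, v, w] ![u, v, w]) =
      t ^ 3 - t * s ^ 2 * (N u v * star (N u v) + N u w * star (N u w) + N v w * star (N v w))
      - s ^ 3 * (N u v * N v w * N w u + star (N u v * N v w * N w u)) := by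
  have e : (t • (1 : Matrix V V ℂ) - s • N).submatrix ![u, v, w] ![u, v, w] =
      !![t, -(s * N u v), -(s * N u w); -(s * star (N u v)), t, -(s * N v w);
        -(s * star (N u w)), -(s * star (N v w)), t] := by
    ext i j
    rw [hherm.apply, hherm.apply, hherm.apply]
    fin_cases i <;> fin_cases j <;> simp [hdiag, huv, huw, hvw, huv.symm, huw.symm, hvw.symm]
  rw [e, det3, ← hherm.apply w u]
  simp only [star_mul', star_star]
  ring

lemma det_shift4 (N : Matrix V V ℂ) (hherm : N.IsHermitian) (hdiag : ∀ u, N u u = 0)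
    (t s : ℂ) (u v w x : V) (huv : u ≠ v) (huw : u ≠ w) (hvw : v ≠ w)
    (hux : u ≠ x) (hvx : v ≠ x) (hwx : w ≠ x) :
    det ((t • (1 : Matrix V V ℂ) - s • N).submatrix ![u, v, w, x] ![u, v, w, x]) =
      t ^ 4 - t ^ 2 * s ^ 2 * (N u v * star (N u v) + N u w * star (N u w) + N u x * star (N u x)
        + N v w * star (N v w) + N v x * star (N v x) + N w x * star (N w x))
      - t * s ^ 3 * ((N u v * N v w * star (N u w) + star (N u v * N v w * star (N u w)))
        + (N u v * N v x * star (N u x) + star (N u v * N v x * star (N u x)))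
        + (N u w * N w x * star (N u x) + star (N u w * N w x * star (N u x)))
        + (N v w * N w x * star (N v x) + star (N v w * N w x * star (N v x))))
      + s ^ 4 * (N u v * star (N u v) * (N w x * star (N w x))
        + N u w * star (N u w) * (N v x * star (N v x))
        + N u x * star (N u x) * (N v w * star (N v w))
        - (N u v * N v w * N w x * star (N u x) + star (N u v * N v w * N w x * star (N u x)))
        - (N u v * N v x * star (N w x) * star (N u w)
          + star (N u v * N v x * star (N w x) * star (N u w)))
        - (N u w * star (N v w) * N v x * star (N u x)
          + star (N u w * star (N v w) * N v x * star (N u x)))) := by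
  have e : (t • (1 : Matrix V V ℂ) - s • N).submatrix ![u, v, w, x] ![u, v, w, x] =
      !![t, -(s * N u v), -(s * N u w), -(s * N u x);
        -(s * star (N u v)), t, -(s * N v w), -(s * N v x);
        -(s * star (N u w)), -(s * star (N v w)), t, -(s * N w x);
        -(s * star (N u x)), -(s * star (N v x)), -(s * star (N w x)), t] := by
    ext i j
    simp only [hherm.apply]
    fin_cases i <;> fin_cases j <;> simp [hdiag, huv, huw, hvw, huv.symm, huw.symm, hvw.symm,
      hux, hvx, hwx, hux.symm, hvx.symm, hwx.symm]
  rw [e, det4]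
  simp only [star_mul', star_star]
  ring

lemma tri_re (N : Matrix V V ℂ) (hherm : N.IsHermitian) (hdiag : ∀ u, N u u = 0)
    (hent : ∀ u v, N u v ∈ ({0, 1, ω6, star ω6} : Set ℂ))
    (h : ∀ i, |hherm.eigenvalues i| < 2)
    (u v w : V) (huv : u ≠ v) (huw : u ≠ w) (hvw : v ≠ w)
    (h1 : N u v ≠ 0) (h2 : N v w ≠ 0) (h3 : N w u ≠ 0) :
    N u v * N v w * N w u ∈ ({ω6, star ω6, -ω6, -star ω6} : Set ℂ) := by
  have h3' : N u w ≠ 0 := by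
    rw [← hherm.apply]; simpa using h3
  have hg : Function.Injective ![u, v, w] := by
    intro i j; fin_cases i <;> fin_cases j <;> simp [huv, huw, hvw, huv.symm, huw.symm, hvw.symm]
  have p1 := det_sub_pos N hherm h 1 (by simp) _ hg
  have p2 := det_sub_pos N hherm h (-1) (by simp) _ hg
  rw [det_shift3 N hherm hdiag _ _ u v w huv huw hvw, ent_mul (hent _ _) h1,
    ent_mul (hent _ _) h2, ent_mul (hent _ _) h3'] at p1 p2
  have h6 : (N u v * N v w * N w u) ^ 6 = 1 := by
    rw [mul_pow, mul_pow, ent_pow (hent _ _) h1, ent_pow (hent _ _) h2, ent_pow (hent _ _) h3]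
    simp
  rcases sixth_cases h6 with h | h | h
  · rw [h] at p1; norm_num at p1
  · rw [h] at p2; norm_num at p2
  · exact h

lemma no_four (N : Matrix V V ℂ) (hherm : N.IsHermitian) (hdiag : ∀ u, N u u = 0)
    (hent : ∀ u v, N u v ∈ ({0, 1, ω6, star ω6} : Set ℂ))
    (h : ∀ i, |hherm.eigenvalues i| < 2)
    (u v w x : V) (huv : u ≠ v) (huw : u ≠ w) (hvw : v ≠ w)
    (hux : u ≠ x) (hvx : v ≠ x) (hwx : w ≠ x)
    (h1 : N u v ≠ 0) (h2 : N v w ≠ 0) (h3 : N w u ≠ 0) (h4 : N u x ≠ 0) : False := by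
  have h3' : N u w ≠ 0 := by
    rw [← hherm.apply]; simpa using h3
  have hg : Function.Injective ![u, v, w, x] := by
    intro i j; fin_cases i <;> fin_cases j <;> simp [huv, huw, hvw, huv.symm, huw.symm, hvw.symm,
      hux, hvx, hwx, hux.symm, hvx.symm, hwx.symm]
  have p1 := det_sub_pos N hherm h 1 (by simp) _ hg
  have p2 := det_sub_pos N hherm h (-1) (by simp) _ hg
  have ht := semi_re (tri_re N hherm hdiag hent h u v w huv huw hvw h1 h2 h3)
  rw [← hherm.apply w u] at ht
  rw [det_shift4 N hherm hdiag _ _ u v w x huv huw hvw hux hvx hwx, ent_mul (hent _ _) h1,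
    ent_mul (hent _ _) h2, ent_mul (hent _ _) h3', ent_mul (hent _ _) h4] at p1 p2
  have a6 := ent_pow (hent _ _) h1
  have d6 := ent_pow (hent _ _) h2
  have b6 := ent_pow (hent _ _) h3'
  have c6 := ent_pow (hent _ _) h4
  have a1 := ent_mul (hent _ _) h1
  have d1 := ent_mul (hent _ _) h2
  have b1 := ent_mul (hent _ _) h3'
  have c1 := ent_mul (hent _ _) h4
  have e1 := ent_mul (hent v x)
  have f1 := ent_mul (hent w x)
  have e6 := ent_pow (hent v x)
  have f6 := ent_pow (hent w x)
  generalize N u v = a at *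
  generalize N u w = b at *
  generalize N u x = c at *
  generalize N v w = d at *
  generalize N v x = e at *
  generalize N w x = f at *
  have st : ∀ {z : ℂ}, z ^ 6 = 1 → star z ^ 6 = 1 := by
    intro z hz
    rw [← star_pow, hz, star_one]
  have r2 : ∀ z : ℂ, (2 * z).re = 2 * z.re := by intro z; simp
  by_cases he : e = 0 <;> by_cases hf : f = 0
  · subst he hf
    simp only [mul_zero, zero_mul, star_zero, add_zero, zero_add, sub_zero, one_mul, mul_one,
      ofReal_one, ofReal_neg] at p1 p2
    norm_num at p1 p2 ht
    rcases ht with ht | ht <;> linarith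
  · subst he
    have hA : (a * d * f * star c) ^ 6 = 1 := by
      simp only [mul_pow, a6, d6, f6 hf, st c6, mul_one]
    have := sixth_re_ge hA
    rw [f1 hf] at p1 p2
    generalize hA' : a * d * f * star c = A at *
    simp only [mul_zero, zero_mul, star_zero, add_zero, zero_add, sub_zero, one_mul, mul_one,
      ofReal_one, ofReal_neg] at p1 p2
    norm_num at p1 p2
    linarith
  · subst hf
    have hA : (b * star d * e * star c) ^ 6 = 1 := by
      simp only [mul_pow, b6, st d6, e6 he, st c6, mul_one]
    have := sixth_re_ge hA
    rw [e1 he] at p1 p2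
    generalize hA' : b * star d * e * star c = A at *
    simp only [mul_zero, zero_mul, star_zero, add_zero, zero_add, sub_zero, one_mul, mul_one,
      ofReal_one, ofReal_neg] at p1 p2
    norm_num at p1 p2
    linarith
  · have hA : (a * d * f * star c) ^ 6 = 1 := by
      simp only [mul_pow, a6, d6, f6 hf, st c6, mul_one]
    have hB : (a * e * star f * star b) ^ 6 = 1 := by
      simp only [mul_pow, a6, e6 he, st (f6 hf), st b6, mul_one]
    have hC : (b * star d * e * star c) ^ 6 = 1 := by
      simp only [mul_pow, b6, st d6, e6 he, st c6, mul_one]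
    have hnot : ¬ (a * d * f * star c = -1 ∧ a * e * star f * star b = -1 ∧
        b * star d * e * star c = -1) := by
      rintro ⟨hA, hB, hC⟩
      have hC' : star (b * star d * e * star c) = -1 := by rw [hC]; simp
      simp only [star_mul', star_star] at hC'
      have hsq : (a * d * star b) ^ 2 = -1 := by
        have e0 : (a * d * f * star c) * (a * e * star f * star b) *
          (star b * d * star e * c) = -1 := by rw [hA, hB, hC']; ring
        have e2 : (a * d * f * star c) * (a * e * star f * star b) *
          (star b * d * star e * c) = (a * d * star b) ^ 2 * (f * star f) * (c * star c)
            * (e * star e) := by ring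
        rw [e2, f1 hf, c1, e1 he] at e0
        simpa using e0
      have h6 : (a * d * star b) ^ 6 = 1 := by
        simp only [mul_pow, a6, d6, st b6, mul_one]
      have : (a * d * star b) ^ 6 = -1 := by
        rw [show (6:ℕ) = 2 * 3 from rfl, pow_mul, hsq]; norm_num
      rw [h6] at this
      norm_num at this
    have gA := sixth_re_ge hA
    have gB := sixth_re_ge hB
    have gC := sixth_re_ge hC
    have key : -5/2 ≤ (a * d * f * star c).re + (a * e * star f * star b).re +
        (b * star d * e * star c).re := by
      rcases sixth_re_ge' hA with h | h
      · rcases sixth_re_ge' hB with h' | h'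
        · rcases sixth_re_ge' hC with h'' | h''
          · exact absurd ⟨h, h', h''⟩ hnot
          · linarith
        · linarith
      · linarith
    rw [f1 hf, e1 he] at p1 p2
    generalize a * d * f * star c = A at *
    generalize a * e * star f * star b = B at *
    generalize b * star d * e * star c = C at *
    generalize a * d * star b = T1 at *
    generalize a * e * star c = T2 at *
    generalize b * f * star c = T3 at *
    generalize d * f * star e = T4 at *
    norm_num at p1 p2
    linarith

lemma eig_det (N : Matrix V V ℂ) (hherm : N.IsHermitian) (i : V) :
    det (((hherm.eigenvalues i : ℝ) : ℂ) • (1 : Matrix V V ℂ) - (1 : ℂ) • N) = 0 := by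
  rw [← exists_mulVec_eq_zero_iff]
  refine ⟨⇑(hherm.eigenvectorBasis i), ?_, ?_⟩
  · intro h0
    apply hherm.eigenvectorBasis.toBasis.ne_zero i
    ext j
    simpa using congrFun h0 j
  · rw [one_smul, sub_mulVec, hherm.mulVec_eigenvectorBasis, smul_mulVec, one_mulVec]
    ext j; simp
end

/-- Let the underlying graph of a mixed graph be connected and contain a
triangle.  Then every eigenvalue of the N-matrix has absolute value `< 2` iff the mixed graph
has exactly `3` vertices and the weight of its triangle lies in `{ω, ω̄, −ω, −ω̄}`. -/
theorem connected_with_triangle_spectral_radius_lt_two_iff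
    {V : Type*} [Fintype V] [DecidableEq V]
    (N : Matrix V V ℂ) (hherm : N.IsHermitian)
    (hdiag : ∀ u, N u u = 0)
    (hent : ∀ u v, N u v ∈ ({0, 1, ω6, star ω6} : Set ℂ))
    (G : SimpleGraph V) (hadj : ∀ u v, G.Adj u v ↔ N u v ≠ 0)
    (hconn : G.Connected)
    (htriangle : ∃ a b c : V, a ≠ b ∧ a ≠ c ∧ b ≠ c ∧ N a b ≠ 0 ∧ N b c ≠ 0 ∧ N c a ≠ 0) :
    (∀ i, |hherm.eigenvalues i| < 2) ↔
      (Fintype.card V = 3 ∧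
        ∀ v₁ v₂ v₃ : V, v₁ ≠ v₂ → v₁ ≠ v₃ → v₂ ≠ v₃ →
          N v₁ v₂ ≠ 0 → N v₂ v₃ ≠ 0 → N v₃ v₁ ≠ 0 →
          N v₁ v₂ * N v₂ v₃ * N v₃ v₁ ∈ ({ω6, star ω6, -ω6, -star ω6} : Set ℂ)) := by
  obtain ⟨a, b, c, hab, hac, hbc, h1, h2, h3⟩ := htriangle
  have hsym : ∀ {u v : V}, N u v ≠ 0 → N v u ≠ 0 := by
    intro u v h
    rw [← hherm.apply]; simpa using h
  constructor
  · intro h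
    refine ⟨?_, fun v₁ v₂ v₃ h12 h13 h23 n1 n2 n3 =>
      tri_re N hherm hdiag hent h v₁ v₂ v₃ h12 h13 h23 n1 n2 n3⟩
    have hcard : ({a, b, c} : Finset V).card = 3 := Finset.card_eq_three.2
      ⟨a, b, c, hab, hac, hbc, rfl⟩
    suffices hall : ∀ x, x ∈ ({a, b, c} : Finset V) by
      rw [← hcard, Finset.eq_univ_iff_forall.2 hall, Finset.card_univ]
    intro x
    by_contra hx
    obtain ⟨p⟩ := hconn.preconnected a x
    obtain ⟨d, -, hd1, hd2⟩ := p.exists_boundary_dart ((({a, b, c} : Finset V)) : Set V)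
      (by simp) (by simpa using hx)
    have hN := (hadj _ _).1 d.adj
    generalize d.fst = q at *
    generalize d.snd = y at *
    simp only [Finset.coe_insert, Finset.coe_singleton, Set.mem_insert_iff,
      Set.mem_singleton_iff, not_or] at hd1 hd2
    obtain ⟨ya, yb, yc⟩ := hd2
    rcases hd1 with rfl | rfl | rfl
    · exact no_four N hherm hdiag hent h q b c y hab hac hbc (Ne.symm ya) (Ne.symm yb)
        (Ne.symm yc) h1 h2 h3 hN
    · exact no_four N hherm hdiag hent h q c a y hbc hab.symm hac.symm (Ne.symm yb) (Ne.symm yc)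
        (Ne.symm ya) h2 h3 h1 hN
    · exact no_four N hherm hdiag hent h q a b y hac.symm hbc.symm hab (Ne.symm yc) (Ne.symm ya)
        (Ne.symm yb) h3 h1 h2 hN
  · rintro ⟨hcard, hw⟩ i
    have hre := semi_re (hw a b c hab hac hbc h1 h2 h3)
    have hg : Function.Injective ![a, b, c] := by
      intro i j
      fin_cases i <;> fin_cases j <;> simp [hab, hac, hbc, hab.symm, hac.symm, hbc.symm]
    have hbij : Function.Bijective ![a, b, c] :=
      (Fintype.bijective_iff_injective_and_card _).2 ⟨hg, by simp [hcard]⟩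
    have hdet := eig_det N hherm i
    rw [← det_submatrix_equiv_self (Equiv.ofBijective _ hbij), Equiv.coe_ofBijective,
      det_shift3 N hherm hdiag _ _ a b c hab hac hbc, ent_mul (hent _ _) h1,
      ent_mul (hent _ _) h2, ent_mul (hent _ _) (hsym h3)] at hdet
    generalize N a b * N b c * N c a = T at *
    generalize hherm.eigenvalues i = l at *
    have hl : l ^ 3 - 3 * l - 2 * T.re = 0 := by
      have := congrArg re hdet
      rw [one_pow, one_pow, one_mul, sub_re, re_add_star, zero_re, sub_re, ← ofReal_pow,
        ofReal_re, mul_one, re_ofReal_mul] at this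
      norm_num at this
      linarith
    rw [abs_lt]
    constructor
    · by_contra hlt
      push Not at hlt
      rcases hre with h | h <;> rw [h] at hl <;> nlinarith [mul_nonneg (sub_nonneg.2 hlt) (sq_nonneg (l - 1))]
    · by_contra hlt
      push Not at hlt
      rcases hre with h | h <;> rw [h] at hl <;> nlinarith [mul_nonneg (sub_nonneg.2 hlt) (sq_nonneg (l + 1))]
end

section
/- Let N be the N-matrix of a mixed graph on a finite vertex set V such that every eigenvalue λ of N satisfies |λ| < 2. Then every vertex has degree at most 3, i.e., for every u ∈ V, the number of vertices v with N_{uv} ≠ 0 is at most 3. -/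
open Matrix Complex

lemma omega6_normSq : Complex.normSq ω6 = 1 := by
  have h : ω6 = ⟨1 / 2, Real.sqrt 3 / 2⟩ := by
    unfold ω6
    apply Complex.ext <;> simp
  have h3 : Real.sqrt 3 * Real.sqrt 3 = 3 := Real.mul_self_sqrt (by norm_num)
  rw [h, Complex.normSq_mk]
  linarith

lemma row_sum_normSq {V : Type*} [Fintype V] [DecidableEq V] (A : Matrix V V ℂ) (u : V) :
    (A * Aᴴ) u u = ((∑ v, Complex.normSq (A u v) : ℝ) : ℂ) := by
  rw [Matrix.mul_apply]
  push_cast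
  refine Finset.sum_congr rfl fun v _ => ?_
  rw [Matrix.conjTranspose_apply, ← Complex.mul_conj]
  rfl

theorem spectral_radius_lt_two_max_degree_le_three
    {V : Type*} [Fintype V] [DecidableEq V]
    (N : Matrix V V ℂ) (hherm : N.IsHermitian)
    (hdiag : ∀ u, N u u = 0)
    (hent : ∀ u v, N u v ∈ ({0, 1, ω6, star ω6} : Set ℂ))
    (hspec : ∀ i, |hherm.eigenvalues i| < 2) :
    ∀ u : V, {v | N u v ≠ 0}.ncard ≤ 3 := by
  intro u
  classical
  set U : Matrix V V ℂ := (hherm.eigenvectorUnitary : Matrix V V ℂ) with hU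
  set D : Matrix V V ℂ := diagonal (fun i => (hherm.eigenvalues i : ℂ)) with hD
  have hUU : U * Uᴴ = 1 := Unitary.mul_star_self_of_mem hherm.eigenvectorUnitary.2
  have hUU' : Uᴴ * U = 1 := Unitary.star_mul_self_of_mem hherm.eigenvectorUnitary.2
  have hN : N = U * D * Uᴴ := by
    have := hherm.spectral_theorem
    rw [Unitary.conjStarAlgAut_apply] at this
    exact this
  have h1 : ∑ i, Complex.normSq (U u i) = 1 := by
    have := row_sum_normSq U u
    rw [hUU, Matrix.one_apply_eq] at this
    exact_mod_cast this.symm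
  have h2 : N * Nᴴ = (U * D) * (U * D)ᴴ := by
    rw [hN]
    simp only [conjTranspose_mul, conjTranspose_conjTranspose]
    calc U * D * Uᴴ * (U * (Dᴴ * Uᴴ)) = U * D * (Uᴴ * U) * (Dᴴ * Uᴴ) := by
          simp only [Matrix.mul_assoc]
      _ = _ := by rw [hUU', Matrix.mul_one]
  have h3 : ∑ v, Complex.normSq (N u v)
      = ∑ i, Complex.normSq (U u i) * hherm.eigenvalues i ^ 2 := by
    have h := row_sum_normSq N u
    rw [h2, row_sum_normSq] at h
    have h' := Complex.ofReal_injective h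
    rw [← h']
    refine Finset.sum_congr rfl fun i _ => ?_
    rw [hD, Matrix.mul_diagonal, Complex.normSq_mul, Complex.normSq_ofReal, sq]
  have h4 : ∑ v, Complex.normSq (N u v) = ({v | N u v ≠ 0}.ncard : ℝ) := by
    have hc : {v | N u v ≠ 0}.ncard = (Finset.univ.filter fun v => N u v ≠ 0).card := by
      rw [← Set.ncard_coe_finset]; simp
    rw [hc, Finset.card_filter]
    push_cast
    refine Finset.sum_congr rfl fun v _ => ?_
    by_cases h0 : N u v = 0
    · simp [h0]
    · rw [if_pos h0]
      rcases hent u v with h | h | h | h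
      · exact absurd h h0
      · rw [h]; simp
      · rw [h, omega6_normSq]
      · rw [Set.mem_singleton_iff] at h
        rw [h]
        exact (Complex.normSq_conj ω6).trans omega6_normSq
  have h5 : ∑ i, Complex.normSq (U u i) * hherm.eigenvalues i ^ 2 < 4 := by
    have hsq : ∀ i, hherm.eigenvalues i ^ 2 < 4 := fun i => by
      have := abs_lt.mp (hspec i)
      nlinarith
    have : ∃ i, U u i ≠ 0 := by
      by_contra! hz
      simp [hz] at h1
    obtain ⟨i, hi⟩ := this
    calc _ < ∑ i, Complex.normSq (U u i) * 4 := by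
          refine Finset.sum_lt_sum (fun j _ => ?_) ⟨i, Finset.mem_univ _, ?_⟩
          · exact mul_le_mul_of_nonneg_left (hsq j).le (Complex.normSq_nonneg _)
          · exact mul_lt_mul_of_pos_left (hsq i) (Complex.normSq_pos.mpr hi)
      _ = 4 := by rw [← Finset.sum_mul, h1, one_mul]
  rw [← h3, h4] at h5
  have : {v | N u v ≠ 0}.ncard < 4 := by exact_mod_cast h5
  omega
end
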